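/- For all integers p ≥ q ≥ 2 with q ≥ 7·log₂ p, every finite indexed family of axis-parallel rectangles in the plane satisfying the (p,q)-property can be pierced by at most p − q + 1 points. -/

import Mathlib

/-- The `(p,q)`-property for a finite indexed family of sets. -/
def HasPQ {ι α : Type*} [Fintype ι] (F : ι → Set α) (p q : ℕ) : Prop :=
  p ≤ Fintype.card ι ∧
    ∀ J : Finset ι, J.card = p → ∃ K ⊆ J, K.card = q ∧ (⋂ k ∈ K, F k).Nonempty

/-- `P` pierces the family `F`: every member of `F` contains a point of `P`. -/
def Pierces {ι α : Type*} (F : ι → Set α) (P : Finset α) : Prop :=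
  ∀ i, ∃ x ∈ P, x ∈ F i

/-- An axis-parallel rectangle in the plane: a nonempty product of two closed
bounded intervals, i.e. `Set.Icc a b` in `ℝ × ℝ` with `a ≤ b`. -/
def IsRect (A : Set (ℝ × ℝ)) : Prop :=
  ∃ a b : ℝ × ℝ, a ≤ b ∧ A = Set.Icc a b

section Piercing

variable {ι α : Type*}

/-- The members of `F` indexed by `S` can be pierced by at most `n` points. -/
def PiercedBy (F : ι → Set α) (S : Finset ι) (n : ℕ) : Prop :=
  ∃ P : Finset α, P.card ≤ n ∧ ∀ i ∈ S, ∃ x ∈ P, x ∈ F i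

/-- The `(p,q)`-property of the subfamily of `F` indexed by `S`. -/
def PQOn (F : ι → Set α) (S : Finset ι) (p q : ℕ) : Prop :=
  p ≤ S.card ∧ ∀ J ⊆ S, J.card = p → ∃ K ⊆ J, K.card = q ∧ ∃ x, ∀ k ∈ K, x ∈ F k

/-- Pairwise intersecting members of `F` have a common point. -/
def PairwiseHelly (F : ι → Set α) : Prop :=
  ∀ T : Finset ι, (∀ i ∈ T, ∀ j ∈ T, (F i ∩ F j).Nonempty) → ∃ x, ∀ i ∈ T, x ∈ F i

open Classical in
/-- The largest number of pairwise disjoint members of `F` indexed by `S`. -/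
noncomputable def packingNumber (F : ι → Set α) (S : Finset ι) : ℕ :=
  (S.powerset.filter fun A : Finset ι => (A : Set ι).PairwiseDisjoint F).sup Finset.card

variable {F : ι → Set α} {S T : Finset ι}

theorem card_le_packingNumber {A : Finset ι} (hAS : A ⊆ S)
    (hA : (A : Set ι).PairwiseDisjoint F) : A.card ≤ packingNumber F S := by
  classical
  exact Finset.le_sup (f := Finset.card)
    (Finset.mem_filter.2 ⟨Finset.mem_powerset.2 hAS, hA⟩)

variable (F S) in
theorem exists_card_eq_packingNumber :
    ∃ A ⊆ S, (A : Set ι).PairwiseDisjoint F ∧ A.card = packingNumber F S := by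
  classical
  obtain ⟨A, hA, h⟩ := Finset.exists_mem_eq_sup
    (S.powerset.filter fun A : Finset ι => (A : Set ι).PairwiseDisjoint F)
    ⟨∅, by simp⟩ Finset.card
  rw [Finset.mem_filter, Finset.mem_powerset] at hA
  exact ⟨A, hA.1, hA.2, h.symm⟩

theorem packingNumber_mono (h : S ⊆ T) : packingNumber F S ≤ packingNumber F T := by
  obtain ⟨A, hA, hd, hc⟩ := exists_card_eq_packingNumber F S
  exact hc ▸ card_le_packingNumber (hA.trans h) hd

theorem packingNumber_pos (h : S.Nonempty) : 0 < packingNumber F S := by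
  obtain ⟨i, hi⟩ := h
  have := card_le_packingNumber (F := F) (S := S) (A := {i}) (by simpa using hi) (by simp)
  simpa [Nat.succ_le_iff] using this

theorem PiercedBy.mono {m n : ℕ} (h : PiercedBy F S m) (hmn : m ≤ n) : PiercedBy F S n := by
  obtain ⟨P, hP, h⟩ := h
  exact ⟨P, hP.trans hmn, h⟩

theorem PiercedBy.subset {n : ℕ} (h : PiercedBy F T n) (hST : S ⊆ T) : PiercedBy F S n := by
  obtain ⟨P, hP, h⟩ := h
  exact ⟨P, hP, fun i hi => h i (hST hi)⟩

theorem PiercedBy.union [DecidableEq ι] {m n : ℕ} (hS : PiercedBy F S m)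
    (hT : PiercedBy F T n) : PiercedBy F (S ∪ T) (m + n) := by
  classical
  obtain ⟨P, hP, hPS⟩ := hS
  obtain ⟨Q, hQ, hQT⟩ := hT
  refine ⟨P ∪ Q, (Finset.card_union_le P Q).trans (by omega), fun i hi => ?_⟩
  rcases Finset.mem_union.1 hi with hi | hi
  · obtain ⟨x, hx, h⟩ := hPS i hi
    exact ⟨x, Finset.mem_union_left _ hx, h⟩
  · obtain ⟨x, hx, h⟩ := hQT i hi
    exact ⟨x, Finset.mem_union_right _ hx, h⟩

theorem piercedBy_empty (n : ℕ) : PiercedBy F ∅ n := ⟨∅, by simp⟩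

theorem piercedBy_card (hne : ∀ i, (F i).Nonempty) (S : Finset ι) : PiercedBy F S S.card := by
  classical
  choose x hx using hne
  exact ⟨S.image x, Finset.card_image_le, fun i hi => ⟨x i, Finset.mem_image_of_mem x hi, hx i⟩⟩

theorem eq_of_not_disjoint {A : Finset ι} (hA : (A : Set ι).PairwiseDisjoint F) {i j : ι}
    (hi : i ∈ A) (hj : j ∈ A) {x : α} (hxi : x ∈ F i) (hxj : x ∈ F j) : i = j := by
  by_contra h
  exact Set.disjoint_left.1 (hA hi hj h) hxi hxj

theorem packingNumber_add_le {X Y : Finset ι} (hne : ∀ i, (F i).Nonempty) (hX : X ⊆ S)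
    (hY : Y ⊆ S) (h : ∀ i ∈ X, ∀ j ∈ Y, Disjoint (F i) (F j)) :
    packingNumber F X + packingNumber F Y ≤ packingNumber F S := by
  classical
  obtain ⟨A, hA, hAd, hAc⟩ := exists_card_eq_packingNumber F X
  obtain ⟨B, hB, hBd, hBc⟩ := exists_card_eq_packingNumber F Y
  have hdis : Disjoint A B := by
    rw [Finset.disjoint_left]
    intro i hiA hiB
    obtain ⟨x, hx⟩ := hne i
    exact Set.disjoint_left.1 (h i (hA hiA) i (hB hiB)) hx hx
  rw [← hAc, ← hBc, ← Finset.card_union_of_disjoint hdis]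
  refine card_le_packingNumber (Finset.union_subset (hA.trans hX) (hB.trans hY)) ?_
  rw [Finset.coe_union]
  exact hAd.union hBd fun i hi j hj _ => h i (hA hi) j (hB hj)

/-- Every member intersects some member of a maximum packing. -/
theorem exists_inter_of_card_eq_packingNumber {A : Finset ι} (hne : ∀ i, (F i).Nonempty)
    (hAS : A ⊆ S) (hA : (A : Set ι).PairwiseDisjoint F) (hc : A.card = packingNumber F S)
    {i : ι} (hi : i ∈ S) : ∃ a ∈ A, (F a ∩ F i).Nonempty := by
  classical
  by_contra! h
  have hd : ∀ a ∈ A, Disjoint (F i) (F a) := fun a ha =>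
    (Set.disjoint_iff_inter_eq_empty.2 (h a ha)).symm
  have hiA : i ∉ A := fun hiA => by
    obtain ⟨x, hx⟩ := hne i
    exact Set.disjoint_left.1 (hd i hiA) hx hx
  have := card_le_packingNumber (F := F) (S := S) (A := insert i A)
    (Finset.insert_subset hi hAS) (by
      rw [Finset.coe_insert]
      exact hA.insert fun j hj _ => hd j hj)
  rw [Finset.card_insert_of_notMem hiA] at this
  omega

theorem piercedBy_one_of_packingNumber_le_one (hne : ∀ i, (F i).Nonempty)
    (hH : PairwiseHelly F) (h : packingNumber F S ≤ 1) : PiercedBy F S 1 := by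
  classical
  obtain ⟨x, hx⟩ := hH S fun i hi j hj => by
    by_contra hij
    rw [Set.not_nonempty_iff_eq_empty, ← Set.disjoint_iff_inter_eq_empty] at hij
    have hne' : i ≠ j := by
      rintro rfl
      obtain ⟨x, hx⟩ := hne i
      exact Set.disjoint_left.1 hij hx hx
    have := card_le_packingNumber (F := F) (S := S) (A := {i, j})
      (by simp [Finset.insert_subset_iff, hi, hj])
      (by
        rw [Finset.coe_pair]
        exact Set.pairwise_pair.2 fun _ => ⟨hij, hij.symm⟩)
    rw [Finset.card_pair hne'] at this
    omega
  exact ⟨{x}, by simp, fun i hi => ⟨x, by simp, hx i hi⟩⟩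

/-- A maximum packing absorbs one of the points piercing the other members. -/
theorem PiercedBy.of_sdiff [DecidableEq ι] {A : Finset ι} {t : ℕ} (hne : ∀ i, (F i).Nonempty)
    (hH : PairwiseHelly F) (hAS : A ⊆ S) (hA : (A : Set ι).PairwiseDisjoint F)
    (hc : A.card = packingNumber F S) (h : PiercedBy F (S \ A) (t + 1)) :
    PiercedBy F S (A.card + t) := by
  classical
  obtain ⟨P, hP, hPS⟩ := h
  rcases P.eq_empty_or_nonempty with rfl | ⟨x, hx⟩
  · have hSA : S ⊆ A := fun i hi => by
      by_contra hiA
      simpa using hPS i (Finset.mem_sdiff.2 ⟨hi, hiA⟩)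
    exact ((piercedBy_card hne A).subset hSA).mono (by omega)
  have hf : ∀ i, ∃ a, i ∈ S → a ∈ A ∧ (F a ∩ F i).Nonempty := fun i => by
    by_cases hi : i ∈ S
    · obtain ⟨a, ha⟩ := exists_inter_of_card_eq_packingNumber hne hAS hA hc hi
      exact ⟨a, fun _ => ha⟩
    · exact ⟨i, fun h => absurd h hi⟩
  choose f hf using hf
  have hy : ∀ a, ∃ y, ∀ i ∈ insert a (S.filter fun i => x ∈ F i ∧ f i = a), y ∈ F i := by
    intro a
    refine hH _ fun i hi j hj => ?_
    simp only [Finset.mem_insert, Finset.mem_filter] at hi hj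
    rcases hi with rfl | ⟨hiS, hxi, rfl⟩ <;> rcases hj with rfl | ⟨hjS, hxj, hj⟩
    · simpa using hne _
    · exact hj ▸ (hf j hjS).2
    · rw [Set.inter_comm]
      exact (hf i hiS).2
    · exact ⟨x, hxi, hxj⟩
  choose y hy using hy
  refine ⟨A.image y ∪ P.erase x, ?_, fun i hi => ?_⟩
  · have h1 := Finset.card_union_le (A.image y) (P.erase x)
    have h2 := Finset.card_image_le (s := A) (f := y)
    have h3 := Finset.card_erase_of_mem hx
    omega
  · by_cases hiA : i ∈ A
    · exact ⟨y i, Finset.mem_union_left _ (Finset.mem_image_of_mem y hiA),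
        hy i i (Finset.mem_insert_self _ _)⟩
    · by_cases hxi : x ∈ F i
      · exact ⟨y (f i), Finset.mem_union_left _ (Finset.mem_image_of_mem y (hf i hi).1),
          hy (f i) i (by simp [hi, hxi])⟩
      · obtain ⟨z, hz, hzi⟩ := hPS i (Finset.mem_sdiff.2 ⟨hi, hiA⟩)
        have hzx : z ≠ x := fun h => hxi (h ▸ hzi)
        exact ⟨z, Finset.mem_union_right _ (Finset.mem_erase.2 ⟨hzx, hz⟩), hzi⟩

theorem card_le_one_of_common_point {A K : Finset ι} [DecidableEq ι]
    (hA : (A : Set ι).PairwiseDisjoint F) {x : α} (hx : ∀ k ∈ K, x ∈ F k) :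
    (K ∩ A).card ≤ 1 := by
  rw [Finset.card_le_one]
  intro i hi j hj
  rw [Finset.mem_inter] at hi hj
  exact eq_of_not_disjoint hA hi.2 hj.2 (hx i hi.1) (hx j hj.1)

theorem PQOn.packingNumber_add_le {p q : ℕ} (h : PQOn F S p q) (hq : 2 ≤ q) :
    packingNumber F S + q ≤ p + 1 := by
  classical
  obtain ⟨A, hAS, hA, hc⟩ := exists_card_eq_packingNumber F S
  rw [← hc]
  rcases le_total A.card p with hAp | hAp
  · obtain ⟨J, hAJ, hJS, hJ⟩ := Finset.exists_subsuperset_card_eq hAS hAp h.1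
    obtain ⟨K, hKJ, hK, x, hx⟩ := h.2 J hJS hJ
    have h1 := card_le_one_of_common_point hA hx
    have h2 := Finset.card_sdiff_add_card_inter K A
    have h3 := Finset.card_le_card (Finset.sdiff_subset_sdiff hKJ (le_refl A))
    have h4 := Finset.card_sdiff_add_card_eq_card hAJ
    omega
  · obtain ⟨J, hJA, hJ⟩ := Finset.exists_subset_card_eq hAp
    obtain ⟨K, hKJ, hK, x, hx⟩ := h.2 J (hJA.trans hAS) hJ
    have h1 := card_le_one_of_common_point hA hx
    rw [Finset.inter_eq_left.2 (hKJ.trans hJA)] at h1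
    omega

theorem PQOn.sdiff [DecidableEq ι] {p q : ℕ} {A : Finset ι} (h : PQOn F S p q) (hAS : A ⊆ S)
    (hA : (A : Set ι).PairwiseDisjoint F) (hAp : A.card ≤ p) :
    PQOn F (S \ A) (p - A.card) (q - 1) := by
  refine ⟨?_, fun J hJ hJc => ?_⟩
  · have := Finset.card_sdiff_add_card_eq_card hAS
    have := h.1
    omega
  · have hdis : Disjoint J A := Finset.disjoint_of_subset_left hJ Finset.sdiff_disjoint
    obtain ⟨K, hKJ, hK, x, hx⟩ := h.2 (J ∪ A)
      (Finset.union_subset (hJ.trans Finset.sdiff_subset) hAS)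
      (by rw [Finset.card_union_of_disjoint hdis]; omega)
    have h1 := card_le_one_of_common_point hA hx
    have h2 := Finset.card_sdiff_add_card_inter K A
    obtain ⟨K', hK', hc⟩ := Finset.exists_subset_card_eq (s := K \ A) (n := q - 1) (by omega)
    refine ⟨K', fun i hi => ?_, hc, x, fun k hk => hx k (Finset.mem_sdiff.1 (hK' hk)).1⟩
    have := Finset.mem_sdiff.1 (hK' hi)
    exact (Finset.mem_union.1 (hKJ this.1)).resolve_right this.2

/-- Removing a maximum packing reduces the `(p,q)`-property to `(p - ν, q - 1)`. -/
theorem PQOn.piercedBy_of_reduction {p q : ℕ} (hne : ∀ i, (F i).Nonempty)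
    (hH : PairwiseHelly F) (hqp : q ≤ p) (hq : 2 ≤ q) (h : PQOn F S p q)
    (ih : ∀ T : Finset ι, PQOn F T (p - packingNumber F S) (q - 1) →
      PiercedBy F T (p - packingNumber F S - (q - 1) + 1)) :
    PiercedBy F S (p - q + 1) := by
  classical
  have hν := h.packingNumber_add_le hq
  obtain ⟨A, hAS, hA, hc⟩ := exists_card_eq_packingNumber F S
  have h1 := h.sdiff hAS hA (by omega)
  rw [hc] at h1
  exact (PiercedBy.of_sdiff hne hH hAS hA hc (ih _ h1)).mono (by omega)

theorem exists_pierce_two_mul_card_le (hne : ∀ i, (F i).Nonempty) (U : Finset ι) :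
    ∃ m, PiercedBy F U m ∧ 2 * m ≤ U.card + packingNumber F U := by
  classical
  induction U using Finset.strongInduction with
  | H U ih =>
    by_cases hU : (U : Set ι).PairwiseDisjoint F
    · exact ⟨U.card, piercedBy_card hne U, by
        have := card_le_packingNumber subset_rfl hU
        omega⟩
    · simp only [Set.PairwiseDisjoint, Set.Pairwise, not_forall, Function.onFun,
        Set.not_disjoint_iff] at hU
      obtain ⟨i, hi, j, hj, hij, x, hxi, hxj⟩ := hU
      have hsub : ({i, j} : Finset ι) ⊆ U := by
        simpa [Finset.insert_subset_iff] using And.intro hi hj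
      obtain ⟨m, hm, hmc⟩ := ih (U \ {i, j}) (Finset.sdiff_ssubset hsub ⟨i, by simp⟩)
      refine ⟨m + 1, ?_, ?_⟩
      · have h1 : PiercedBy F {i, j} 1 :=
          ⟨{x}, by simp, fun k hk => ⟨x, by simp, by
            rcases Finset.mem_insert.1 hk with rfl | hk
            · exact hxi
            · exact Finset.mem_singleton.1 hk ▸ hxj⟩⟩
        exact (hm.union h1).subset (Finset.sdiff_union_of_subset hsub).ge
      · have h1 := Finset.card_sdiff_add_card_eq_card hsub
        rw [Finset.card_pair hij] at h1
        have h2 := packingNumber_mono (F := F) (Finset.sdiff_subset (s := U) (t := {i, j}))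
        omega

variable (F S) in
/-- Greedily removing `k` packings leaves a subfamily with a small packing number. -/
theorem exists_subset_depth_le [DecidableEq ι] (k : ℕ) :
    ∃ U ⊆ S, (∀ K ⊆ U, (∃ x, ∀ i ∈ K, x ∈ F i) → K.card ≤ k) ∧
      k * packingNumber F (S \ U) ≤ U.card := by
  induction k with
  | zero =>
    exact ⟨∅, by simp, fun K hK _ => by simp [Finset.subset_empty.1 hK], by simp⟩
  | succ k ih =>
    obtain ⟨U, hUS, hU, hUc⟩ := ih
    obtain ⟨A, hAS, hA, hc⟩ := exists_card_eq_packingNumber F (S \ U)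
    refine ⟨U ∪ A, Finset.union_subset hUS (hAS.trans Finset.sdiff_subset), ?_, ?_⟩
    · rintro K hK ⟨x, hx⟩
      have h1 := card_le_one_of_common_point hA hx
      have h2 := Finset.card_sdiff_add_card_inter K A
      have h3 := hU (K \ A) (fun i hi => by
          have := Finset.mem_sdiff.1 hi
          exact (Finset.mem_union.1 (hK this.1)).resolve_right this.2)
        ⟨x, fun i hi => hx i (Finset.mem_sdiff.1 hi).1⟩
      omega
    · have hdis : Disjoint U A :=
        (Finset.disjoint_of_subset_left hAS Finset.sdiff_disjoint).symm
      rw [Finset.card_union_of_disjoint hdis]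
      have h1 : packingNumber F (S \ (U ∪ A)) ≤ packingNumber F (S \ U) :=
        packingNumber_mono (Finset.sdiff_subset_sdiff le_rfl Finset.subset_union_left)
      nlinarith

end Piercing

section Rectangles

variable {ι : Type*} {a b : ι → ℝ × ℝ}

theorem pairwiseHelly_Icc (a b : ι → ℝ × ℝ) : PairwiseHelly fun i => Set.Icc (a i) (b i) := by
  intro T hT
  rcases T.eq_empty_or_nonempty with rfl | hne
  · exact ⟨0, by simp⟩
  · refine ⟨T.sup' hne a, fun i hi => ⟨Finset.le_sup' a hi, Finset.sup'_le hne a fun j hj => ?_⟩⟩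
    obtain ⟨x, hxi, hxj⟩ := hT i hi j hj
    exact hxj.1.trans hxi.2

/-- Rectangles crossing a vertical line behave like intervals. -/
theorem piercedBy_packingNumber_of_crossing (hab : ∀ i, a i ≤ b i) (t : ℝ) (C : Finset ι)
    (hC : ∀ i ∈ C, (a i).1 ≤ t ∧ t ≤ (b i).1) :
    PiercedBy (fun i => Set.Icc (a i) (b i)) C
      (packingNumber (fun i => Set.Icc (a i) (b i)) C) := by
  classical
  induction C using Finset.strongInduction with
  | H C ih =>
    rcases C.eq_empty_or_nonempty with rfl | hne
    · exact piercedBy_empty _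
    obtain ⟨i, hi, hmin⟩ := C.exists_min_image (fun i => (b i).2) hne
    set D := C.filter fun j => (b i).2 < (a j).2 with hD
    have hDC : D ⊆ C := Finset.filter_subset _ _
    have hiD : i ∉ D := fun h => by
      have := (Finset.mem_filter.1 h).2
      exact absurd (hab i).2 (not_le.2 this)
    have h1 := ih D (Finset.ssubset_iff_subset_ne.2 ⟨hDC, fun h => hiD (h ▸ hi)⟩)
      fun j hj => hC j (hDC hj)
    have h2 : PiercedBy (fun i => Set.Icc (a i) (b i)) (C \ D) 1 := by
      refine ⟨{(t, (b i).2)}, by simp, fun j hj => ⟨_, Finset.mem_singleton_self _, ?_⟩⟩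
      obtain ⟨hjC, hjD⟩ := Finset.mem_sdiff.1 hj
      have hj2 : (a j).2 ≤ (b i).2 := by
        by_contra hlt
        exact hjD (Finset.mem_filter.2 ⟨hjC, not_le.1 hlt⟩)
      exact ⟨⟨(hC j hjC).1, hj2⟩, ⟨(hC j hjC).2, hmin j hjC⟩⟩
    refine ((h2.union h1).subset (Finset.sdiff_union_of_subset hDC).ge).mono ?_
    refine le_trans (Nat.add_le_add_right ?_ _)
      (packingNumber_add_le (X := {i}) (Y := D) (fun j => Set.nonempty_Icc.2 (hab j))
        (by simpa using hi) hDC ?_)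
    · exact packingNumber_pos (Finset.singleton_nonempty i)
    · intro k hk j hj
      rw [Finset.mem_singleton.1 hk, Set.disjoint_left]
      intro x hxi hxj
      have := (Finset.mem_filter.1 hj).2
      exact absurd (hxj.1.2.trans hxi.2.2) (not_le.2 this)

/-- Divide and conquer: `n * r` points suffice when the packing number is at most `n < 2 ^ r`. -/
theorem piercedBy_mul_of_packingNumber_le (hab : ∀ i, a i ≤ b i) (r : ℕ) :
    ∀ (n : ℕ) (S : Finset ι), packingNumber (fun i => Set.Icc (a i) (b i)) S ≤ n → n < 2 ^ r →
      PiercedBy (fun i => Set.Icc (a i) (b i)) S (n * r) := by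
  classical
  set F : ι → Set (ℝ × ℝ) := fun i => Set.Icc (a i) (b i) with hF
  have hne : ∀ i, (F i).Nonempty := fun i => Set.nonempty_Icc.2 (hab i)
  induction r with
  | zero =>
    intro n S hS hn
    rcases S.eq_empty_or_nonempty with rfl | hne
    · exact piercedBy_empty _
    · have := packingNumber_pos (F := F) hne
      omega
  | succ r ih =>
    intro n S hS hn
    rw [pow_succ] at hn
    have hdeep : ∀ L ⊆ S, n / 2 < packingNumber F L →
        ∃ j ∈ L, n / 2 < packingNumber F (S.filter fun i => (b i).1 ≤ (b j).1) := by
      intro L hL hLn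
      obtain ⟨A, hA, hd, hc⟩ := exists_card_eq_packingNumber F L
      obtain ⟨j, hj, hmax⟩ := A.exists_max_image (fun i => (b i).1)
        (Finset.card_pos.1 (by omega))
      refine ⟨j, hA hj, hLn.trans_le (hc ▸ card_le_packingNumber (fun i hi => ?_) hd)⟩
      exact Finset.mem_filter.2 ⟨hL (hA hi), hmax i hi⟩
    rcases le_or_gt (packingNumber F S) (n / 2) with h | h
    · refine (ih (n / 2) S h (by omega)).mono ?_
      exact Nat.mul_le_mul (Nat.div_le_self n 2) (Nat.le_succ r)
    obtain ⟨j, hj, hjn⟩ := hdeep S subset_rfl h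
    obtain ⟨k, hk, hmin⟩ := Finset.exists_min_image
      (S.filter fun j => n / 2 < packingNumber F (S.filter fun i => (b i).1 ≤ (b j).1))
      (fun i => (b i).1) ⟨j, Finset.mem_filter.2 ⟨hj, hjn⟩⟩
    rw [Finset.mem_filter] at hk
    set t := (b k).1
    set L := S.filter fun i => (b i).1 < t with hL
    set R := S.filter fun i => t < (a i).1 with hR
    set C := S.filter fun i => (a i).1 ≤ t ∧ t ≤ (b i).1 with hC
    have hLn : packingNumber F L ≤ n / 2 := by
      by_contra! hlt
      obtain ⟨i, hi, hin⟩ := hdeep L (Finset.filter_subset _ _) hlt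
      have hi' := Finset.mem_filter.1 hi
      exact absurd (hmin i (Finset.mem_filter.2 ⟨hi'.1, hin⟩)) (not_le.2 hi'.2)
    have hRn := packingNumber_add_le (F := F) (S := S)
      (X := S.filter fun i => (b i).1 ≤ t) (Y := R) hne
      (Finset.filter_subset _ _) (Finset.filter_subset _ _) (by
        intro i hi j hj
        rw [Set.disjoint_left]
        intro x hxi hxj
        have hi := (Finset.mem_filter.1 hi).2
        have hj := (Finset.mem_filter.1 hj).2
        linarith [hxi.2.1, hxj.1.1])
    have hcover : S ⊆ (L ∪ R) ∪ C := fun i hi => by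
      simp only [hL, hR, hC, Finset.mem_union, Finset.mem_filter, hi, true_and]
      rcases lt_or_ge (b i).1 t with h1 | h1
      · exact .inl (.inl h1)
      · rcases lt_or_ge t (a i).1 with h2 | h2
        · exact .inl (.inr h2)
        · exact .inr ⟨h2, h1⟩
    have h1 := ih (n / 2) L hLn (by omega)
    have h2 := ih (n - n / 2 - 1) R (by omega) (by omega)
    have h3 := piercedBy_packingNumber_of_crossing hab t C
      fun i hi => (Finset.mem_filter.1 hi).2
    have h4 : packingNumber F C ≤ packingNumber F S :=
      packingNumber_mono (Finset.filter_subset _ _)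
    refine (((h1.union h2).union h3).subset hcover).mono ?_
    have h5 : n / 2 * r + (n - n / 2 - 1) * r ≤ n * r := by
      rw [← add_mul]
      exact Nat.mul_le_mul_right r (by omega)
    rw [Nat.mul_succ]
    exact Nat.add_le_add h5 (h4.trans hS)

variable {S : Finset ι}

theorem piercedBy_of_add_two_le_two_mul {α : Type*} {F : ι → Set α}
    (hne : ∀ i, (F i).Nonempty) (hH : PairwiseHelly F) (p : ℕ) :
    ∀ (q : ℕ) (S : Finset ι), 2 ≤ q → q ≤ p → p + 2 ≤ 2 * q → PQOn F S p q →
      PiercedBy F S (p - q + 1) := by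
  induction p using Nat.strong_induction_on with
  | h p ih =>
    intro q S hq hqp hpq h
    have hν := h.packingNumber_add_le hq
    rcases le_or_gt (packingNumber F S) 1 with h1 | h1
    · exact (piercedBy_one_of_packingNumber_le_one hne hH h1).mono (by omega)
    · exact h.piercedBy_of_reduction hne hH hqp hq fun T hT =>
        ih _ (by omega) _ T (by omega) (by omega) (by omega) hT

theorem piercedBy_of_add_fourteen_le_four_mul (hab : ∀ i, a i ≤ b i) (p : ℕ) :
    ∀ (q : ℕ) (S : Finset ι), q ≤ p → p + 14 ≤ 4 * q →
      PQOn (fun i => Set.Icc (a i) (b i)) S p q →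
      PiercedBy (fun i => Set.Icc (a i) (b i)) S (p - q + 1) := by
  have hne : ∀ i, (Set.Icc (a i) (b i)).Nonempty := fun i => Set.nonempty_Icc.2 (hab i)
  have hH := pairwiseHelly_Icc a b
  induction p using Nat.strong_induction_on with
  | h p ih =>
    intro q S hqp hpq h
    have hν := h.packingNumber_add_le (by omega)
    rcases le_or_gt (packingNumber (fun i => Set.Icc (a i) (b i)) S) 3 with h1 | h1
    · rcases le_or_gt 6 (p - q + 1) with h2 | h2
      · exact (piercedBy_mul_of_packingNumber_le hab 2 3 S h1 (by norm_num)).mono (by omega)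
      · exact piercedBy_of_add_two_le_two_mul hne hH p q S (by omega) hqp (by omega) h
    · exact h.piercedBy_of_reduction hne hH hqp (by omega) fun T hT =>
        ih _ (by omega) _ T (by omega) (by omega) hT

theorem piercedBy_of_packingNumber_lt (hab : ∀ i, a i ≤ b i) {p q : ℕ} (hq : 2 ≤ q)
    (hqp : q ≤ p) (hlog : p ^ 7 ≤ 2 ^ q)
    (hν : 10 * packingNumber (fun i => Set.Icc (a i) (b i)) S < p) (hpq : 4 * q < p + 14)
    (h : PQOn (fun i => Set.Icc (a i) (b i)) S p q) :
    PiercedBy (fun i => Set.Icc (a i) (b i)) S (p - q + 1) := by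
  classical
  set F : ι → Set (ℝ × ℝ) := fun i => Set.Icc (a i) (b i) with hF
  have hne : ∀ i, (F i).Nonempty := fun i => Set.nonempty_Icc.2 (hab i)
  have hlarge : ∀ c k : ℕ, c ≤ p → 2 ^ k ≤ c ^ 7 → k ≤ q := fun c k hc hk =>
    (Nat.pow_le_pow_iff_right one_lt_two).1 (hk.trans ((Nat.pow_le_pow_left hc 7).trans hlog))
  have hq7 : 7 ≤ q := hlarge 2 7 (by omega) (by norm_num)
  have hq27 : 27 ≤ q := hlarge 15 27 (by omega) (by norm_num)
  set r := Nat.log 2 p with hr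
  have hrp : 2 ^ r ≤ p := Nat.pow_log_le_self 2 (by omega)
  have hpr : p < 2 ^ (r + 1) := Nat.lt_pow_succ_log_self one_lt_two p
  have hrq : 7 * r ≤ q := hlarge (2 ^ r) (7 * r) hrp (by rw [← pow_mul, mul_comm])
  have hr1 : 1 ≤ r := Nat.log_pos one_lt_two (by omega)
  obtain ⟨U, hUS, hU, hUc⟩ := exists_subset_depth_le F S (q - 1)
  have hUp : U.card < p := by
    by_contra! hpU
    obtain ⟨J, hJU, hJ⟩ := Finset.exists_subset_card_eq hpU
    obtain ⟨K, hKJ, hK, hx⟩ := h.2 J (hJU.trans hUS) hJ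
    have := hU K (hKJ.trans hJU) hx
    omega
  obtain ⟨m, hm, hmc⟩ := exists_pierce_two_mul_card_le hne U
  have hUν : packingNumber F U ≤ packingNumber F S := packingNumber_mono hUS
  set n := packingNumber F (S \ U) with hn
  have h6 : 6 * n ≤ (q - 1) * n := Nat.mul_le_mul_right n (by omega)
  have h6r : 6 * r * n ≤ (q - 1) * n := Nat.mul_le_mul_right n (by omega)
  rw [pow_succ] at hpr
  have h1 := piercedBy_mul_of_packingNumber_le hab r n (S \ U) le_rfl (by omega)
  refine ((h1.union hm).subset (Finset.sdiff_union_of_subset hUS).ge).mono ?_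
  have h7 : 6 * (n * r) ≤ U.card := by
    calc 6 * (n * r) = 6 * r * n := by ring
      _ ≤ _ := h6r.trans hUc
  omega

theorem piercedBy_of_pow_seven_le_two_pow (hab : ∀ i, a i ≤ b i) (p : ℕ) :
    ∀ (q : ℕ) (S : Finset ι), 2 ≤ q → q ≤ p → p ^ 7 ≤ 2 ^ q →
      PQOn (fun i => Set.Icc (a i) (b i)) S p q →
      PiercedBy (fun i => Set.Icc (a i) (b i)) S (p - q + 1) := by
  have hne : ∀ i, (Set.Icc (a i) (b i)).Nonempty := fun i => Set.nonempty_Icc.2 (hab i)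
  induction p using Nat.strong_induction_on with
  | h p ih =>
    intro q S hq hqp hlog h
    have hν := h.packingNumber_add_le hq
    rcases le_or_gt (p + 14) (4 * q) with h2 | h2
    · exact piercedBy_of_add_fourteen_le_four_mul hab p q S hqp h2 h
    rcases lt_or_ge (10 * packingNumber (fun i => Set.Icc (a i) (b i)) S) p with h1 | h1
    · exact piercedBy_of_packingNumber_lt hab hq hqp hlog h1 h2 h
    have hq7 : 7 ≤ q := (Nat.pow_le_pow_iff_right one_lt_two).1
      ((Nat.pow_le_pow_left (hq.trans hqp) 7).trans hlog)
    refine h.piercedBy_of_reduction hne (pairwiseHelly_Icc a b) hqp hq fun T hT =>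
      ih _ (by omega) _ T (by omega) (by omega) ?_ hT
    generalize packingNumber (fun i => Set.Icc (a i) (b i)) S = ν at *
    have h3 : (10 * (p - ν)) ^ 7 ≤ (9 * p) ^ 7 := Nat.pow_le_pow_left (by omega) 7
    rw [mul_pow, mul_pow] at h3
    obtain ⟨k, rfl⟩ : ∃ k, q = k + 1 := ⟨q - 1, by omega⟩
    rw [pow_succ 2 k] at hlog
    rw [Nat.add_sub_cancel]
    norm_num at h3
    omega

end Rectangles

/-- Theorem 1.5: `HD_rect(p,q) = p - q + 1` for all `q ≥ 7 log₂ p`. -/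
theorem rect_tight_pq {ι : Type} [Fintype ι] (F : ι → Set (ℝ × ℝ))
    (hrect : ∀ i, IsRect (F i))
    (p q : ℕ) (hq2 : 2 ≤ q) (hqp : q ≤ p)
    (hlog : 7 * Real.logb 2 (p : ℝ) ≤ (q : ℝ))
    (hpq : HasPQ F p q) :
    ∃ P : Finset (ℝ × ℝ), P.card ≤ p - q + 1 ∧ Pierces F P := by
  choose a b hab hF using hrect
  obtain rfl : F = fun i => Set.Icc (a i) (b i) := funext hF
  have hpow : p ^ 7 ≤ 2 ^ q := by
    have hp : (0 : ℝ) < p := by exact_mod_cast (by omega : 0 < p)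
    have h : Real.logb 2 ((p : ℝ) ^ 7) ≤ q := by
      rw [Real.logb_pow]
      exact_mod_cast hlog
    rw [Real.logb_le_iff_le_rpow one_lt_two (pow_pos hp 7), Real.rpow_natCast] at h
    exact_mod_cast h
  have h : PQOn (fun i => Set.Icc (a i) (b i)) Finset.univ p q := by
    refine ⟨hpq.1, fun J _ hJ => ?_⟩
    obtain ⟨K, hKJ, hK, x, hx⟩ := hpq.2 J hJ
    exact ⟨K, hKJ, hK, x, fun k hk => Set.mem_iInter₂.1 hx k hk⟩
  obtain ⟨P, hP, hPF⟩ := piercedBy_of_pow_seven_le_two_pow hab p q _ hq2 hqp hpow h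
  exact ⟨P, hP, fun i => hPF i (Finset.mem_univ i)⟩
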